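/- arXiv:0804.1344 — 2 statements merged into one kernel-verified Lean document; each statement's English description precedes it below -/
import Mathlib

section
/- The Chinese monoid CH(X) on a linearly ordered set X satisfies exactly the defining relations of the presentation with relation set S: x_i x_j x_k = x_j x_i x_k, x_i x_k x_j = x_j x_i x_k, x_i x_j x_j = x_j x_i x_j, x_i x_i x_j = x_i x_j x_i, and x_i x_j x_i x_k = x_i x_k x_i x_j for i > j > k; that is, the monoid presented by S is isomorphic to the monoid presented by the Chinese relations cba = bca = cab (c ≥ b ≥ a). -/
open FreeMonoid

/-- The Chinese relations `cba = bca` and `cba = cab` for `a ≤ b ≤ c`. -/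
def chineseRel (X : Type*) [LinearOrder X] : FreeMonoid X → FreeMonoid X → Prop :=
  fun u v => ∃ a b c : X, a ≤ b ∧ b ≤ c ∧
    u = of c * of b * of a ∧
    (v = of b * of c * of a ∨ v = of c * of a * of b)

/-- The relation set `S`: `x_i x_j x_k = x_j x_i x_k`, `x_i x_k x_j = x_j x_i x_k`,
`x_i x_j x_j = x_j x_i x_j`, `x_i x_i x_j = x_i x_j x_i`,
`x_i x_j x_i x_k = x_i x_k x_i x_j` for `i > j > k`. -/
def sRel (X : Type*) [LinearOrder X] : FreeMonoid X → FreeMonoid X → Prop :=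
  fun u v =>
    (∃ i j : X, j < i ∧
      ((u = of i * of j * of j ∧ v = of j * of i * of j) ∨
       (u = of i * of i * of j ∧ v = of i * of j * of i))) ∨
    (∃ i j k : X, k < j ∧ j < i ∧
      ((u = of i * of j * of k ∧ v = of j * of i * of k) ∨
       (u = of i * of k * of j ∧ v = of j * of i * of k) ∨
       (u = of i * of j * of i * of k ∧ v = of i * of k * of i * of j)))

theorem chinese_conGen_eq (X : Type*) [LinearOrder X] :
    conGen (chineseRel X) = conGen (sRel X) := by
  apply le_antisymm
  · rw [Con.conGen_le]
    rintro u v ⟨a, b, c, hab, hbc, rfl, rfl | rfl⟩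
    · rcases hbc.eq_or_lt with rfl | hbc
      · exact Con.refl _ _
      · rcases hab.eq_or_lt with rfl | hab
        · exact ConGen.Rel.of _ _ (Or.inl ⟨c, a, hbc, Or.inl ⟨rfl, rfl⟩⟩)
        · exact ConGen.Rel.of _ _ (Or.inr ⟨c, b, a, hab, hbc, Or.inl ⟨rfl, rfl⟩⟩)
    · rcases hab.eq_or_lt with rfl | hab
      · exact Con.refl _ _
      · rcases hbc.eq_or_lt with rfl | hbc
        · exact ConGen.Rel.of _ _ (Or.inl ⟨b, a, hab, Or.inr ⟨rfl, rfl⟩⟩)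
        · exact Con.trans _ (ConGen.Rel.of _ _
            (Or.inr ⟨c, b, a, hab, hbc, Or.inl ⟨rfl, rfl⟩⟩))
            (Con.symm _ (ConGen.Rel.of _ _
              (Or.inr ⟨c, b, a, hab, hbc, Or.inr (Or.inl ⟨rfl, rfl⟩)⟩)))
  · have h1 : ∀ a b c : X, a ≤ b → b ≤ c →
        conGen (chineseRel X) (of c * of b * of a) (of b * of c * of a) :=
      fun a b c h h' => ConGen.Rel.of _ _ ⟨a, b, c, h, h', rfl, Or.inl rfl⟩
    have h2 : ∀ a b c : X, a ≤ b → b ≤ c →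
        conGen (chineseRel X) (of c * of b * of a) (of c * of a * of b) :=
      fun a b c h h' => ConGen.Rel.of _ _ ⟨a, b, c, h, h', rfl, Or.inr rfl⟩
    rw [Con.conGen_le]
    rintro u v (⟨i, j, hji, ⟨rfl, rfl⟩ | ⟨rfl, rfl⟩⟩ |
      ⟨i, j, k, hkj, hji, ⟨rfl, rfl⟩ | ⟨rfl, rfl⟩ | ⟨rfl, rfl⟩⟩)
    · exact h1 j j i le_rfl hji.le
    · exact h2 j i i hji.le le_rfl
    · exact h1 k j i hkj.le hji.le
    · exact Con.trans _ (Con.symm _ (h2 k j i hkj.le hji.le)) (h1 k j i hkj.le hji.le)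
    · have e1 := Con.mul _ (Con.refl (conGen (chineseRel X)) (of i))
        (Con.trans _ (Con.symm _ (h1 k j i hkj.le hji.le)) (h2 k j i hkj.le hji.le))
      have e2 := Con.mul _ (h2 k i i (hkj.trans hji).le le_rfl)
        (Con.refl (conGen (chineseRel X)) (of j))
      simp only [mul_assoc] at e1 e2 ⊢
      exact Con.trans _ e1 e2

/-- The monoid presented by the Chinese relations is isomorphic to the monoid
presented by the relation set `S`, via an isomorphism fixing the generators. -/
theorem chinese_presentation_eq {X : Type*} [LinearOrder X] :
    ∃ e : (conGen (chineseRel X)).Quotient ≃* (conGen (sRel X)).Quotient,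
      ∀ x : X, e ((conGen (chineseRel X)).mk' (of x)) =
        (conGen (sRel X)).mk' (of x) := by
  rw [chinese_conGen_eq X]
  exact ⟨MulEquiv.refl _, fun _ => rfl⟩
end

section
/- Let X be a finite linearly ordered set x_1 < x_2 < ... < x_n. Every element of the Chinese monoid CH(X) is represented by a staircase word, i.e., a word of the form w_1 w_2 ⋯ w_n where w_i = (x_i x_1)^{t_{i1}} (x_i x_2)^{t_{i2}} ⋯ (x_i x_{i-1})^{t_{i(i-1)}} x_i^{t_{ii}} with all exponents non-negative integers. -/
open FreeMonoid

/-- The Chinese monoid on `{x_1 < ... < x_n}` (indexed here by `Fin n`). -/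
abbrev CH (n : ℕ) := (conGen (chineseRel (Fin n))).Quotient

/-- The image of the generator `x_i` in the Chinese monoid. -/
def chGen {n : ℕ} (i : Fin n) : CH n := (conGen (chineseRel (Fin n))).mk' (of i)

theorem ch_rel1 {n : ℕ} {a b c : Fin n} (hab : a ≤ b) (hbc : b ≤ c) :
    chGen c * chGen b * chGen a = chGen b * chGen c * chGen a := by
  unfold chGen
  simp only [← map_mul]
  exact (Con.eq _).2 (ConGen.Rel.of _ _ ⟨a, b, c, hab, hbc, rfl, Or.inl rfl⟩)

theorem ch_rel2 {n : ℕ} {a b c : Fin n} (hab : a ≤ b) (hbc : b ≤ c) :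
    chGen c * chGen b * chGen a = chGen c * chGen a * chGen b := by
  unfold chGen
  simp only [← map_mul]
  exact (Con.eq _).2 (ConGen.Rel.of _ _ ⟨a, b, c, hab, hbc, rfl, Or.inr rfl⟩)

/-- `x_b` commutes with `x_c x_a` for `a ≤ b ≤ c`. -/
theorem ch_comm {n : ℕ} {a b c : Fin n} (hab : a ≤ b) (hbc : b ≤ c) :
    Commute (chGen b) (chGen c * chGen a) := by
  change chGen b * (chGen c * chGen a) = chGen c * chGen a * chGen b
  rw [← mul_assoc, ← ch_rel1 hab hbc, ch_rel2 hab hbc]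

theorem ch_comm_pair {n : ℕ} {a b c : Fin n} (ha : a ≤ c) (hb : b ≤ c) :
    Commute (chGen c * chGen a) (chGen c * chGen b) := by
  rcases le_total a b with h | h
  · exact ((ch_comm ha le_rfl).mul_left (ch_comm h hb)).symm
  · exact (ch_comm hb le_rfl).mul_left (ch_comm h ha)

theorem list_prod_add_single {M ι : Type*} [Monoid M] [DecidableEq ι] (f : ι → M) (s : ι → ℕ)
    (y : ι) (L : List ι) (hc : ∀ k ∈ L, Commute (f y) (f k)) (hy : y ∈ L) (hn : L.Nodup) :
    (L.map fun k => f k ^ ((s + Pi.single y 1 : ι → ℕ) k)).prod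
      = (L.map fun k => f k ^ (s k)).prod * f y := by
  induction L with
  | nil => simp at hy
  | cons a L ih =>
    rw [List.nodup_cons] at hn
    simp only [List.map_cons, List.prod_cons]
    by_cases h : y = a
    · subst h
      have h1 : (L.map fun k => f k ^ ((s + Pi.single y 1 : ι → ℕ) k)) = L.map fun k => f k ^ (s k) := by
        apply List.map_congr_left
        intro k hk
        have : k ≠ y := fun e => hn.1 (e ▸ hk)
        simp [this]
      have h2 : Commute (f y) (L.map fun k => f k ^ (s k)).prod := by
        apply Commute.list_prod_right
        intro x hx
        obtain ⟨k, hk, rfl⟩ := List.mem_map.1 hx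
        exact (hc k (List.mem_cons_of_mem _ hk)).pow_right _
      rw [h1, mul_assoc, ← h2.eq, ← mul_assoc]
      simp [pow_succ]
    · have hy' : y ∈ L := (List.mem_cons.1 hy).resolve_left h
      rw [ih (fun k hk => hc k (List.mem_cons_of_mem _ hk)) hy' hn.2, mul_assoc]
      have : a ≠ y := fun e => h e.symm
      simp [this]

/-- The product of pairs in row `c`. -/
def chPairs {n : ℕ} (c : Fin n) (s : Fin n → ℕ) : CH n :=
  (((List.finRange n).filter (fun j => j < c)).map (fun j => (chGen c * chGen j) ^ (s j))).prod

theorem chPairs_congr {n : ℕ} (c : Fin n) (s s' : Fin n → ℕ) (h : ∀ j < c, s j = s' j) :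
    chPairs c s = chPairs c s' := by
  unfold chPairs
  congr 1
  apply List.map_congr_left
  intro k hk
  rw [h k (by simpa using hk)]

theorem chPairs_add {n : ℕ} (c : Fin n) (s : Fin n → ℕ) (y : Fin n) (hy : y < c) :
    chPairs c (s + Pi.single y 1) = chPairs c s * (chGen c * chGen y) := by
  unfold chPairs
  apply list_prod_add_single (fun j => chGen c * chGen j)
  · intro k hk
    have hk : k < c := by simpa using hk
    exact ch_comm_pair hy.le hk.le
  · simpa using hy
  · exact (List.nodup_finRange n).filter _

theorem chPairs_comm {n : ℕ} (c : Fin n) (s : Fin n → ℕ) (y : Fin n) (hy : y ≤ c)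
    (h : ∀ k < c, s k ≠ 0 → k ≤ y) : Commute (chGen y) (chPairs c s) := by
  apply Commute.list_prod_right
  intro x hx
  obtain ⟨k, hk, rfl⟩ := List.mem_map.1 hx
  have hk : k < c := by simpa using hk
  by_cases h0 : s k = 0
  · rw [h0, pow_zero]; exact Commute.one_right _
  · exact (ch_comm (h k hk h0) hy).pow_right _

theorem ex_single {n : ℕ} (s : Fin n → ℕ) (c : Fin n) (h : s c ≠ 0) :
    ∃ s0 : Fin n → ℕ, s = s0 + Pi.single c 1 := by
  refine ⟨s - Pi.single c 1, ?_⟩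
  funext k
  by_cases hk : k = c
  · subst hk; simp; omega
  · simp [hk]

theorem chRow_mul {n : ℕ} (c j : Fin n) (s : Fin n → ℕ) (hj : j < c) :
    (∃ s', chPairs c s * chGen c ^ s c * chGen j = chPairs c s' * chGen c ^ s' c) ∨
    ∃ y < c, ∃ s', chPairs c s * chGen c ^ s c * chGen j
      = chGen y * (chPairs c s' * chGen c ^ s' c) := by
  by_cases hc : s c = 0
  · right
    by_cases hm : ∀ k < c, s k ≠ 0 → k ≤ j
    · refine ⟨j, hj, s, ?_⟩
      rw [hc, pow_zero, mul_one, (chPairs_comm c s j hj.le hm).eq]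
    · push Not at hm
      obtain ⟨k, hk, hk0, hjk⟩ := hm
      obtain ⟨y, hy, hmax⟩ := (Finset.univ.filter fun k => k < c ∧ s k ≠ 0).exists_max_image id
        ⟨k, by simp [hk, hk0]⟩
      simp only [Finset.mem_filter, Finset.mem_univ, true_and, id] at hy hmax
      have hjy : j < y := hjk.trans_le (hmax k ⟨hk, hk0⟩)
      obtain ⟨s0, rfl⟩ := ex_single s y hy.2
      have hcy : c ≠ y := hy.1.ne'
      have hcj : c ≠ j := hj.ne'
      have hc0 : s0 c = 0 := by simpa [hcy] using hc
      have hcom : Commute (chGen y) (chPairs c s0) := by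
        apply chPairs_comm c s0 y hy.1.le
        intro k hk hk0
        apply hmax k ⟨hk, _⟩
        simp only [Pi.add_apply]; omega
      refine ⟨y, hy.1, s0 + Pi.single j 1, ?_⟩
      rw [hc, chPairs_add _ _ _ hy.1, chPairs_add _ _ _ hj]
      simp only [Pi.add_apply, Pi.single_apply, hcj, hc0, if_false, add_zero, pow_zero, mul_one]
      rw [mul_assoc, ch_rel1 hjy.le hy.1.le, mul_assoc (chGen y), ← mul_assoc, ← hcom.eq, mul_assoc]
  · left
    obtain ⟨s0, rfl⟩ := ex_single s c hc
    refine ⟨s0 + Pi.single j 1, ?_⟩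
    have hcj : c ≠ j := hj.ne'
    rw [chPairs_add _ _ _ hj, chPairs_congr c (s0 + Pi.single c 1) s0
      (fun k hk => by simp [hk.ne])]
    have h := (ch_comm (n := n) hj.le (le_refl c)).pow_left (s0 c)
    simp only [Pi.add_apply, Pi.single_apply, hcj, if_false, add_zero, if_true]
    rw [pow_succ, mul_assoc, mul_assoc (chGen c ^ s0 c), h.eq, ← mul_assoc]

/-- Product of the rows indexed by a list. -/
def chStair {n : ℕ} (l : List (Fin n)) (t : Fin n → Fin n → ℕ) : CH n :=
  (l.map fun i => chPairs i (t i) * chGen i ^ t i i).prod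

theorem chStair_update {n : ℕ} (l : List (Fin n)) (t : Fin n → Fin n → ℕ) (c : Fin n)
    (s : Fin n → ℕ) (hc : c ∉ l) :
    chStair (l ++ [c]) (Function.update t c s)
      = chStair l t * (chPairs c s * chGen c ^ s c) := by
  unfold chStair
  rw [List.map_append, List.prod_append]
  congr 1
  · congr 1
    apply List.map_congr_left
    intro k hk
    have : k ≠ c := fun e => hc (e ▸ hk)
    simp [this]
  · simp

theorem chStair_mul {n : ℕ} (l : List (Fin n)) : ∀ (r : List (Fin n)),
    l ++ r = List.finRange n → ∀ (t : Fin n → Fin n → ℕ), ∀ j ∈ l,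
    ∃ t', chStair l t * chGen j = chStair l t' := by
  induction l using List.reverseRecOn with
  | nil => intro r _ t j hj; simp at hj
  | append_singleton l c ih =>
    intro r hr t j hj
    have hr' : l ++ (c :: r) = List.finRange n := by simpa using hr
    have hs : (l ++ (c :: r)).Pairwise (· < ·) := by
      rw [hr']; exact List.pairwise_lt_finRange n
    rw [List.pairwise_append, List.pairwise_cons] at hs
    have hcl : c ∉ l := fun h => lt_irrefl c (hs.2.2 c h c (by simp))
    have hlt : ∀ y < c, y ∈ l := by
      intro y hy
      have : y ∈ l ++ (c :: r) := by rw [hr']; simp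
      rcases List.mem_append.1 this with h | h
      · exact h
      · rcases List.mem_cons.1 h with h | h
        · exact absurd h hy.ne
        · exact absurd (hs.2.1.1 y h) hy.not_gt
    have ht := chStair_update l t c (t c) hcl
    rw [Function.update_eq_self] at ht
    rw [ht]
    rcases List.mem_append.1 hj with h | h
    · have hjc : j < c := hs.2.2 j h c (by simp)
      rcases chRow_mul c j (t c) hjc with ⟨s', h'⟩ | ⟨y, hy, s', h'⟩
      · exact ⟨Function.update t c s', by rw [chStair_update _ _ _ _ hcl, mul_assoc, h']⟩
      · obtain ⟨t', h2⟩ := ih _ hr' t y (hlt y hy)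
        exact ⟨Function.update t' c s', by
          rw [chStair_update _ _ _ _ hcl, mul_assoc, h', ← mul_assoc, h2]⟩
    · have : j = c := by simpa using h
      subst this
      refine ⟨Function.update t j (t j + Pi.single j 1), ?_⟩
      rw [chStair_update _ _ _ _ hcl, chPairs_congr j (t j + Pi.single j 1) (t j)
        (fun k hk => by simp [hk.ne])]
      simp [pow_succ, mul_assoc]

theorem ch_exists {n : ℕ} (w : List (Fin n)) :
    ∃ t, (w.map chGen).prod = chStair (List.finRange n) t := by
  induction w using List.reverseRecOn with
  | nil =>
    refine ⟨fun _ _ => 0, ?_⟩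
    simp [chStair, chPairs]
  | append_singleton w j ih =>
    obtain ⟨t, h⟩ := ih
    obtain ⟨t', h'⟩ := chStair_mul (List.finRange n) [] (by simp) t j (by simp)
    exact ⟨t', by simp [h, h']⟩

theorem ch_mk {n : ℕ} (w : FreeMonoid (Fin n)) :
    (conGen (chineseRel (Fin n))).mk' w = ((FreeMonoid.toList w).map chGen).prod := by
  induction w using FreeMonoid.inductionOn' with
  | one => simp
  | of_mul a w ih =>
    rw [map_mul, ih, FreeMonoid.toList_of_mul, List.map_cons, List.prod_cons]
    rfl

/-- Every element of the Chinese monoid `CH(X)` on `X = {x_1 < ... < x_n}` is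
represented by a staircase word `w_1 w_2 ⋯ w_n`, where
`w_i = (x_i x_1)^{t_{i1}} (x_i x_2)^{t_{i2}} ⋯ (x_i x_{i-1})^{t_{i(i-1)}} x_i^{t_{ii}}`. -/
theorem chinese_staircase_normal_form {n : ℕ} (g : CH n) :
    ∃ t : Fin n → Fin n → ℕ,
      g = ((List.finRange n).map (fun i =>
            ((((List.finRange n).filter (fun j => j < i)).map
                (fun j => (chGen i * chGen j) ^ (t i j))).prod)
              * (chGen i) ^ (t i i))).prod := by
  induction g using Con.induction_on with
  | H w =>
    obtain ⟨t, h⟩ := ch_exists (FreeMonoid.toList w)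
    refine ⟨t, ?_⟩
    change _ = chStair (List.finRange n) t
    rw [← h]
    exact ch_mk w
end
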